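/- arXiv:2008.08779 — 8 statements merged into one kernel-verified Lean document; each statement's English description precedes it below -/
import Mathlib

section
/- For every tournament T and every weight function w : V(T) → ℚ≥0, there exists a feedback vertex set X of T with w(X) ≤ (7/3)·SA₁(T,w). In particular, since SA₁(T,w) ≤ OPT(T,w), X satisfies w(X) ≤ (7/3)·OPT(T,w). -/
variable {V : Type*}

/-- A directed triangle: arcs `a → b`, `b → c`, `c → a`. -/
def Triangle (arc : V → V → Prop) (a b c : V) : Prop :=
  arc a b ∧ arc b c ∧ arc c a

/-- A tournament: an irreflexive relation with exactly one arc between any two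
distinct vertices. -/
def IsTournament (arc : V → V → Prop) : Prop :=
  (∀ v, ¬ arc v v) ∧ ∀ a b : V, a ≠ b → (arc a b ↔ ¬ arc b a)

/-- A feedback vertex set: removing `X` leaves no directed triangle. -/
def IsFVS (arc : V → V → Prop) (X : Set V) : Prop :=
  ∀ a b c : V, a ∉ X → b ∉ X → c ∉ X → ¬ Triangle arc a b c

/-- The constraints of the first level of the Sherali–Adams hierarchy applied to
the basic relaxation of the feedback vertex set problem of a tournament:
`x` is the vector of vertex variables, `y` the (symmetric) lift over pairs. -/
def SA1Feasible (arc : V → V → Prop) (x : V → ℝ) (y : V → V → ℝ) : Prop :=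
  (∀ a b, y a b = y b a) ∧
  (∀ a, 0 ≤ x a ∧ x a ≤ 1) ∧
  (∀ a b c, Triangle arc a b c → 1 + y a b + y b c ≤ x a + x b + x c) ∧
  (∀ a b c d, Triangle arc a b c → d ≠ a → d ≠ b → d ≠ c →
    x d ≤ y a d + y b d + y c d ∧
    1 + y a d + y b d + y c d ≤ x a + x b + x c + x d) ∧
  (∀ a b, a ≠ b → y a b ≤ x a ∧ 0 ≤ y a b)

/-- `SA₁(T,w)`: the optimum value of the level-1 Sherali-Adams relaxation. -/
noncomputable def SA1Val [Fintype V] (arc : V → V → Prop) (w : V → ℚ) : ℝ :=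
  sInf {t : ℝ | ∃ x y, SA1Feasible arc x y ∧ t = ∑ v, (w v : ℝ) * x v}

/-- The vertex `x` completes the arc `s → t` to a directed triangle. -/
def Completes (arc : V → V → Prop) (s t x : V) : Prop :=
  arc s t ∧ arc t x ∧ arc x s

/-- Two vertices complete a common arc to directed triangles. -/
def Diagonal (arc : V → V → Prop) (u v : V) : Prop :=
  ∃ s t, Completes arc s t u ∧ Completes arc s t v

/-- No directed triangle contains two diagonal pairs. -/
def Light (arc : V → V → Prop) : Prop :=
  ∀ a b c, Triangle arc a b c → Diagonal arc a b → ¬ Diagonal arc b c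

theorem IsTournament.asymm {arc : V → V → Prop} (hT : IsTournament arc) {a b : V}
    (h : arc a b) : ¬ arc b a := by
  have hab : a ≠ b := by rintro rfl; exact hT.1 a h
  exact (hT.2 a b hab).1 h

theorem IsTournament.arc_of_not {arc : V → V → Prop} (hT : IsTournament arc) {a b : V}
    (hab : a ≠ b) (h : ¬ arc a b) : arc b a :=
  (hT.2 b a hab.symm).2 h

theorem IsTournament.total {arc : V → V → Prop} (hT : IsTournament arc) (a b : V) :
    a = b ∨ arc a b ∨ arc b a := by
  by_cases hab : a = b
  · exact Or.inl hab
  · by_cases h : arc a b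
    · exact Or.inr (Or.inl h)
    · exact Or.inr (Or.inr (hT.arc_of_not hab h))

theorem Triangle.rotate {arc : V → V → Prop} {a b c : V} (h : Triangle arc a b c) :
    Triangle arc b c a :=
  ⟨h.2.1, h.2.2, h.1⟩

theorem IsTournament.reverse {arc : V → V → Prop} (hT : IsTournament arc) :
    IsTournament (fun a b => arc b a) :=
  ⟨hT.1, fun a b hab => hT.2 b a hab.symm⟩

theorem Diagonal.symm {arc : V → V → Prop} {u v : V} (h : Diagonal arc u v) :
    Diagonal arc v u := by
  obtain ⟨s, t, hu, hv⟩ := h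
  exact ⟨s, t, hv, hu⟩

theorem Diagonal.of_reverse {arc : V → V → Prop} {u v : V}
    (h : Diagonal (fun a b => arc b a) u v) : Diagonal arc u v := by
  obtain ⟨s, t, ⟨h1, h2, h3⟩, -, h5, h6⟩ := h
  exact ⟨t, s, ⟨h1, h3, h2⟩, h1, h6, h5⟩

theorem Light.reverse {arc : V → V → Prop} (hL : Light arc) :
    Light (fun a b => arc b a) := fun a b c h hab hbc =>
  hL c b a ⟨h.2.1, h.1, h.2.2⟩ hbc.of_reverse.symm hab.of_reverse.symm

/-- The vertices completing a given arc span no directed triangle. -/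
theorem Light.not_triangle_of_completes {arc : V → V → Prop} (hL : Light arc) {s t a b c : V}
    (ha : Completes arc s t a) (hb : Completes arc s t b) (hc : Completes arc s t c) :
    ¬ Triangle arc a b c :=
  fun h => hL a b c h ⟨s, t, ha, hb⟩ ⟨s, t, hb, hc⟩

theorem Light.false_of_double_dominator {arc : V → V → Prop} (hT : IsTournament arc)
    (hL : Light arc) {p a b c u w : V} (h : Triangle arc a b c)
    (ha : arc a p) (hb : arc b p) (hc : arc c p) (hu : arc p u) (hw : arc p w)
    (hua : arc u a) (hub : arc u b) (hwc : arc w c) : False := by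
  have dab : Diagonal arc a b := ⟨p, u, ⟨hu, hua, ha⟩, hu, hub, hb⟩
  rcases hT.total u c with rfl | huc | hcu
  · exact hT.asymm hub h.2.1
  · exact hL a b c h dab ⟨p, u, ⟨hu, hub, hb⟩, hu, huc, hc⟩
  rcases hT.total w a with rfl | hwa | haw
  · exact hT.asymm hwc h.2.2
  · exact hL c a b h.rotate.rotate ⟨p, w, ⟨hw, hwc, hc⟩, hw, hwa, ha⟩ dab
  · exact hL u a p ⟨hua, ha, hu⟩ ⟨b, c, ⟨h.2.1, hcu, hub⟩, h.2.1, h.2.2, h.1⟩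
      ⟨w, c, ⟨hwc, h.2.2, haw⟩, hwc, hc, hw⟩

theorem Light.false_of_dominators_arc {arc : V → V → Prop}
    (hL : Light arc) {p a b c u₁ u₂ u₃ : V} (h : Triangle arc a b c)
    (ha : arc a p) (hb : arc b p) (hc : arc c p)
    (h₁ : arc p u₁) (h₂ : arc p u₂) (h₃ : arc p u₃)
    (h₁a : arc u₁ a) (h₂b : arc u₂ b) (h₃c : arc u₃ c) (hbu₁ : arc b u₁) (hau₃ : arc a u₃)
    (h₁₂ : arc u₁ u₂) : False :=
  hL a p u₁ ⟨ha, h₁, h₁a⟩ ⟨u₃, c, ⟨h₃c, h.2.2, hau₃⟩, h₃c, hc, h₃⟩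
    ⟨u₂, b, ⟨h₂b, hb, h₂⟩, h₂b, hbu₁, h₁₂⟩

/-- In a light tournament, the vertices which reach a vertex `p` by an arc and are reached from
`p` by a path with two arcs span no directed triangle. -/
theorem Light.not_triangle_of_dominated {arc : V → V → Prop} (hT : IsTournament arc)
    (hL : Light arc) {p a b c : V} (ha : arc a p) (hb : arc b p) (hc : arc c p)
    (ha' : ∃ u, arc p u ∧ arc u a) (hb' : ∃ u, arc p u ∧ arc u b)
    (hc' : ∃ u, arc p u ∧ arc u c) : ¬ Triangle arc a b c := by
  intro h
  obtain ⟨u₁, h₁, h₁a⟩ := ha'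
  obtain ⟨u₂, h₂, h₂b⟩ := hb'
  obtain ⟨u₃, h₃, h₃c⟩ := hc'
  have hr := h.rotate
  have hrr := hr.rotate
  have hbu₁ : arc b u₁ := by
    rcases hT.total u₁ b with rfl | h' | h'
    · exact (hT.asymm h.1 h₁a).elim
    · exact (hL.false_of_double_dominator hT h ha hb hc h₁ h₃ h₁a h' h₃c).elim
    · exact h'
  have hcu₂ : arc c u₂ := by
    rcases hT.total u₂ c with rfl | h' | h'
    · exact (hT.asymm h.2.1 h₂b).elim
    · exact (hL.false_of_double_dominator hT hr hb hc ha h₂ h₁ h₂b h' h₁a).elim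
    · exact h'
  have hau₃ : arc a u₃ := by
    rcases hT.total u₃ a with rfl | h' | h'
    · exact (hT.asymm h.2.2 h₃c).elim
    · exact (hL.false_of_double_dominator hT hrr hc ha hb h₃ h₂ h₃c h' h₂b).elim
    · exact h'
  have hcu₁ : arc c u₁ := by
    rcases hT.total u₁ c with rfl | h' | h'
    · exact (hT.asymm h₁ hc).elim
    · exact (hL.false_of_double_dominator hT hrr hc ha hb h₁ h₂ h' h₁a h₂b).elim
    · exact h'
  have h₂₁ : arc u₂ u₁ := by
    rcases hT.total u₁ u₂ with rfl | h' | h'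
    · exact (hT.asymm h₂b hbu₁).elim
    · exact (hL.false_of_dominators_arc h ha hb hc h₁ h₂ h₃ h₁a h₂b h₃c hbu₁ hau₃ h').elim
    · exact h'
  have h₃₂ : arc u₃ u₂ := by
    rcases hT.total u₂ u₃ with rfl | h' | h'
    · exact (hT.asymm h₃c hcu₂).elim
    · exact (hL.false_of_dominators_arc hr hb hc ha h₂ h₃ h₁ h₂b h₃c h₁a hcu₂ hbu₁ h').elim
    · exact h'
  have h₁₃ : arc u₁ u₃ := by
    rcases hT.total u₃ u₁ with rfl | h' | h'
    · exact (hT.asymm h₁a hau₃).elim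
    · exact (hL.false_of_dominators_arc hrr hc ha hb h₃ h₁ h₂ h₃c h₁a h₂b hau₃ hcu₂ h').elim
    · exact h'
  have hbu₃ : arc b u₃ := by
    rcases hT.total u₃ b with rfl | h' | h'
    · exact (hT.asymm h₃ hb).elim
    · exact (hL.false_of_double_dominator hT hr hb hc ha h₃ h₁ h' h₃c h₁a).elim
    · exact h'
  exact hL b u₁ a ⟨hbu₁, h₁a, h.1⟩ ⟨u₃, u₂, ⟨h₃₂, h₂b, hbu₃⟩, h₃₂, h₂₁, h₁₃⟩
    ⟨u₃, c, ⟨h₃c, hcu₁, h₁₃⟩, h₃c, h.2.2, hau₃⟩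

/-- The dual of `Light.not_triangle_of_dominated`. -/
theorem Light.not_triangle_of_dominating {arc : V → V → Prop} (hT : IsTournament arc)
    (hL : Light arc) {z a b c : V} (ha : arc z a) (hb : arc z b) (hc : arc z c)
    (ha' : ∃ w, arc a w ∧ arc w z) (hb' : ∃ w, arc b w ∧ arc w z)
    (hc' : ∃ w, arc c w ∧ arc w z) : ¬ Triangle arc a b c := by
  intro h
  refine hL.reverse.not_triangle_of_dominated hT.reverse (p := z) hc hb ha ?_ ?_ ?_
    ⟨h.2.1, h.1, h.2.2⟩
  · obtain ⟨w, h1, h2⟩ := hc'; exact ⟨w, h2, h1⟩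
  · obtain ⟨w, h1, h2⟩ := hb'; exact ⟨w, h2, h1⟩
  · obtain ⟨w, h1, h2⟩ := ha'; exact ⟨w, h2, h1⟩

/-- A directed triangle near the end of a shortest path `s → r → q → p` meeting the vertices
completing `s → r` and the in-neighbours of `p` in two vertices each. -/
theorem Light.not_triangle_of_path_end {arc : V → V → Prop} (hT : IsTournament arc)
    (hL : Light arc) {s r p a m b u : V} (hpr : arc p r) (ha : Completes arc s r a)
    (hm : Completes arc s r m) (hpa : arc p a) (hmp : arc m p) (hbr : arc b r)
    (hbp : arc b p) (hpu : arc p u) (hub : arc u b) : ¬ Triangle arc a m b := by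
  intro h
  obtain ⟨ham, hmb, hba⟩ := h
  have dam : Diagonal arc a m := ⟨s, r, ha, hm⟩
  rcases hT.total u m with rfl | hum | hmu
  · exact hT.asymm hpu hmp
  · exact hL a m b ⟨ham, hmb, hba⟩ dam ⟨p, u, ⟨hpu, hum, hmp⟩, hpu, hub, hbp⟩
  rcases hT.total u a with rfl | hua | hau
  · exact hT.asymm hub hba
  · exact hL u b p ⟨hub, hbp, hpu⟩ ⟨a, m, ⟨ham, hmu, hua⟩, ham, hmb, hba⟩
      ⟨r, m, ⟨hm.2.1, hmb, hbr⟩, hm.2.1, hmp, hpr⟩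
  · exact hL p a m ⟨hpa, ham, hmp⟩ ⟨u, b, ⟨hub, hbp, hpu⟩, hub, hba, hau⟩ dam

open Classical in
/-- The class of a vertex in layer `n` with profile `p`, where `p i` records whether the vertex
has an arc to the `i`-th vertex of a path. -/
noncomputable def profileClass (n : ℤ) (p : ℤ → Prop) : ℤ :=
  if n % 2 = 0 then
    if p (n - 1) ∧ ¬ p n then n / 2 - 1
    else if p n ∧ ¬ p (n + 1) then n / 2 + 1
    else n / 2
  else
    if ¬ p (n - 1) then n / 2 - 1
    else if p (n + 1) then n / 2 + 2
    else if p n then n / 2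
    else n / 2 + 1

theorem profileClass_bounds (n : ℤ) (p : ℤ → Prop) :
    2 * profileClass n p - 3 ≤ n ∧ n ≤ 2 * profileClass n p + 3 := by
  unfold profileClass
  split_ifs <;> omega

/-- Each class splits into a lower, a middle and an upper part. -/
theorem profileClass_cases {n k : ℤ} {p : ℤ → Prop} (hlow : ∀ i, i + 2 ≤ n → p i)
    (hhigh : ∀ i, n + 2 ≤ i → ¬ p i) (hk : profileClass n p = k) :
    ((p (2 * k - 2) ∧ ¬ p (2 * k - 1)) ∧ ¬ p (2 * k + 1) ∧
      (n ≤ 2 * k - 2 ∨ n ≤ 2 * k ∧ ¬ p (2 * k))) ∨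
    ((p (2 * k - 2) ∧ ¬ p (2 * k - 1)) ∧ (p (2 * k + 1) ∧ ¬ p (2 * k + 2))) ∨
    (p (2 * k - 2) ∧ p (2 * k - 1) ∧ (p (2 * k + 1) ∧ ¬ p (2 * k + 2)) ∧
      (2 * k + 2 ≤ n ∨ 2 * k ≤ n ∧ p (2 * k))) := by
  have hlow' : ∀ i, p i ∨ n < i + 2 := fun i => by
    by_cases h : i + 2 ≤ n
    · exact Or.inl (hlow i h)
    · exact Or.inr (by omega)
  have hhigh' : ∀ i, ¬ p i ∨ i < n + 2 := fun i => by
    by_cases h : n + 2 ≤ i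
    · exact Or.inl (hhigh i h)
    · exact Or.inr (by omega)
  clear hlow hhigh
  unfold profileClass at hk
  have l1 := hlow' (2 * k - 2)
  have l2 := hlow' (2 * k - 1)
  have l3 := hlow' (2 * k + 1)
  have u1 := hhigh' (2 * k - 1)
  have u2 := hhigh' (2 * k + 1)
  have u3 := hhigh' (2 * k + 2)
  clear hlow' hhigh'
  have hn : n = 2 * (n / 2) ∨ n = 2 * (n / 2) + 1 := by omega
  generalize n / 2 = e at hn hk
  rcases hn with rfl | rfl <;> split_ifs at hk <;> subst hk <;> grind

/-- A layering of a tournament together with the profiles of the vertices with respect to a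
path yields a partition into four classes without directed triangles. -/
theorem exists_coloring_of_profile {arc : V → V → Prop}
    (hasymm : ∀ x y, arc x y → ¬ arc y x) (ℓ : V → ℤ) (P : V → ℤ → Prop)
    (hlayer : ∀ x y, ℓ y + 2 ≤ ℓ x → arc x y)
    (hlow : ∀ x i, i + 2 ≤ ℓ x → P x i) (hhigh : ∀ x i, ℓ x + 2 ≤ i → ¬ P x i)
    (hblock : ∀ i a b c, P a i ∧ ¬ P a (i + 1) → P b i ∧ ¬ P b (i + 1) →
      P c i ∧ ¬ P c (i + 1) → ¬ Triangle arc a b c)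
    (hmix : ∀ i a m b, Even i → P a i ∧ ¬ P a (i + 1) → ¬ P a (i + 3) →
      P m i ∧ ¬ P m (i + 1) → P m (i + 3) ∧ ¬ P m (i + 4) → P b i → P b (i + 1) →
      P b (i + 3) ∧ ¬ P b (i + 4) → ¬ Triangle arc a m b)
    (hsep : ∀ i a b, ¬ P a i → ¬ P a (i + 1) → ¬ P a (i + 2) → P b i → P b (i + 1) →
      P b (i + 2) → ¬ arc a b) :
    ∃ f : V → ZMod 4, ∀ a b c, f a = f b → f b = f c → ¬ Triangle arc a b c := by
  set K : V → ℤ := fun x => profileClass (ℓ x) (P x) with hK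
  have hmono : ∀ x y, ((K x : ℤ) : ZMod 4) = (K y : ℤ) → arc x y → K y ≤ K x := by
    intro x y hxy harc
    by_contra! hlt
    rw [ZMod.intCast_eq_intCast_iff_dvd_sub] at hxy
    have h4 : K x + 4 ≤ K y := by
      push_cast at hxy
      omega
    have hx := profileClass_bounds (ℓ x) (P x)
    have hy := profileClass_bounds (ℓ y) (P y)
    refine hasymm x y harc (hlayer y x ?_)
    simp only [hK] at h4
    omega
  refine ⟨fun x => (K x : ZMod 4), fun a b c hab hbc htri => ?_⟩
  have h1 := hmono a b hab htri.1
  have h2 := hmono b c hbc htri.2.1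
  have h3 := hmono c a (hab.trans hbc).symm htri.2.2
  obtain ⟨k, hka⟩ : ∃ k, K a = k := ⟨_, rfl⟩
  have hkb : K b = k := by omega
  have hkc : K c = k := by omega
  clear h1 h2 h3 hab hbc hmono
  have key := fun x (hx : K x = k) => profileClass_cases (hlow x) (hhigh x) hx
  have e1 : 2 * k - 2 + 1 = 2 * k - 1 := by ring
  have e3 : 2 * k - 2 + 3 = 2 * k + 1 := by ring
  have e4 : 2 * k - 2 + 4 = 2 * k + 2 := by ring
  have f1 : 2 * k - 1 + 1 = 2 * k := by ring
  have f2 : 2 * k - 1 + 2 = 2 * k + 1 := by ring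
  have g1 : 2 * k + 1 + 1 = 2 * k + 2 := by ring
  have hlo := hblock (2 * k - 2)
  have hup := hblock (2 * k + 1)
  have hm := fun a m b => hmix (2 * k - 2) a m b ⟨k - 1, by ring⟩
  have hs := hsep (2 * k - 1)
  rw [e1] at hlo
  rw [g1] at hup
  simp only [e1, e3, e4] at hm
  simp only [f1, f2] at hs
  clear hblock hmix hsep hlow hhigh
  have hrot : ∀ a b c, Triangle arc a b c → K a = k → K b = k → K c = k →
      (P a (2 * k - 2) ∧ ¬ P a (2 * k - 1)) ∧ ¬ P a (2 * k + 1) ∧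
        (ℓ a ≤ 2 * k - 2 ∨ ℓ a ≤ 2 * k ∧ ¬ P a (2 * k)) → False := by
    intro a b c htri ha hb hc hA
    have hno : ∀ y, P y (2 * k - 2) ∧ P y (2 * k - 1) ∧
        (P y (2 * k + 1) ∧ ¬ P y (2 * k + 2)) ∧
        (2 * k + 2 ≤ ℓ y ∨ 2 * k ≤ ℓ y ∧ P y (2 * k)) →
        ∀ x, (P x (2 * k - 2) ∧ ¬ P x (2 * k - 1)) ∧ ¬ P x (2 * k + 1) ∧
        (ℓ x ≤ 2 * k - 2 ∨ ℓ x ≤ 2 * k ∧ ¬ P x (2 * k)) → ¬ arc x y := by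
      intro y hy x hx hxy
      by_cases hl : ℓ x + 2 ≤ ℓ y
      · exact hasymm x y hxy (hlayer y x hl)
      · have hx0 : ¬ P x (2 * k) := by
          rcases hx.2.2 with h | h
          · rcases hy.2.2.2 with h' | h' <;> omega
          · exact h.2
        have hy0 : P y (2 * k) := by
          rcases hy.2.2.2 with h | h
          · rcases hx.2.2 with h' | h' <;> omega
          · exact h.2
        exact hs x y hx.1.2 hx0 hx.2.1 hy.2.1 hy0 hy.2.2.1.1 hxy
    rcases key b hb with hB | hB | hB
    · rcases key c hc with hC | hC | hC
      · exact hlo a b c hA.1 hB.1 hC.1 htri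
      · exact hlo a b c hA.1 hB.1 hC.1 htri
      · exact hno c hC b hB htri.2.1
    · rcases key c hc with hC | hC | hC
      · exact hlo a b c hA.1 hB.1 hC.1 htri
      · exact hlo a b c hA.1 hB.1 hC.1 htri
      · exact hm a b c hA.1 hA.2.1 hB.1 hB.2 hC.1 hC.2.1 hC.2.2.1 htri
    · exact hno b hB a hA htri.1
  have hup' : ∀ x, K x = k →
      (P x (2 * k - 2) ∧ ¬ P x (2 * k - 1)) ∧ ¬ P x (2 * k + 1) ∧
        (ℓ x ≤ 2 * k - 2 ∨ ℓ x ≤ 2 * k ∧ ¬ P x (2 * k)) ∨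
      (P x (2 * k + 1) ∧ ¬ P x (2 * k + 2)) := by
    intro x hx
    rcases key x hx with h | h | h
    · exact Or.inl h
    · exact Or.inr h.2
    · exact Or.inr h.2.2.1
  rcases hup' a hka with hA | hA
  · exact hrot a b c htri hka hkb hkc hA
  rcases hup' b hkb with hB | hB
  · exact hrot b c a htri.rotate hkb hkc hka hB
  rcases hup' c hkc with hC | hC
  · exact hrot c a b htri.rotate.rotate hkc hka hkb hC
  exact hup a b c hA hB hC htri

/-- The vertices reached from `z` by a walk with `n` arcs. -/
def walkEnds (arc : V → V → Prop) (z : V) : ℕ → Set V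
  | 0 => {z}
  | n + 1 => {y | ∃ x ∈ walkEnds arc z n, arc x y}

theorem exists_layering (arc : V → V → Prop) (z : V) (h : ∀ x, ∃ n, x ∈ walkEnds arc z n) :
    ∃ ℓ : V → ℕ, (∀ x, ℓ x = 0 ↔ x = z) ∧ (∀ x, ℓ x ≠ 0 → ∃ y, arc y x ∧ ℓ y + 1 = ℓ x) ∧
      ∀ x y, arc x y → ℓ y ≤ ℓ x + 1 := by
  classical
  refine ⟨fun x => Nat.find (h x), fun x => ?_, fun x hx => ?_, fun x y hxy => ?_⟩
  · simp [Nat.find_eq_zero, walkEnds]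
  · obtain ⟨n, hn⟩ := Nat.exists_eq_succ_of_ne_zero hx
    have hs := Nat.find_spec (h x)
    simp only at hn
    rw [hn] at hs
    obtain ⟨y, hy, hyx⟩ := hs
    refine ⟨y, hyx, ?_⟩
    simp only [hn]
    have h1 : Nat.find (h y) ≤ n := Nat.find_min' (h y) hy
    have h2 : Nat.find (h x) ≤ Nat.find (h y) + 1 :=
      Nat.find_min' (h x) ⟨y, Nat.find_spec (h y), hyx⟩
    omega
  · exact Nat.find_min' (h y) ⟨x, Nat.find_spec (h x), hxy⟩

theorem exists_layered_path {arc : V → V → Prop} {ℓ : V → ℕ}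
    (hpred : ∀ x, ℓ x ≠ 0 → ∃ y, arc y x ∧ ℓ y + 1 = ℓ x) (k : ℕ) (p : V) (hp : ℓ p = k) :
    ∃ v : ℕ → V, v k = p ∧ (∀ i ≤ k, ℓ (v i) = i) ∧ ∀ i < k, arc (v i) (v (i + 1)) := by
  induction k generalizing p with
  | zero => exact ⟨fun _ => p, rfl, fun i hi => by simp_all, by simp⟩
  | succ k ih =>
    obtain ⟨y, hyp, hy⟩ := hpred p (by omega)
    obtain ⟨v, hvk, hvl, hva⟩ := ih y (by omega)
    refine ⟨fun i => if i ≤ k then v i else p, by simp, fun i hi => ?_, fun i hi => ?_⟩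
    · rcases Nat.lt_or_ge k i with h | h
      · have : i = k + 1 := by omega
        subst this
        simp [hp]
      · simp [h, hvl i h]
    · rcases Nat.lt_or_ge i k with h | h
      · have h1 : i ≤ k := h.le
        have h2 : i + 1 ≤ k := h
        simp [h1, h2, hva i h]
      · have : i = k := by omega
        subst this
        simp [hvk, hyp]

/-- In a tournament, a vertex of minimum out-degree can be reached from each of its
out-neighbours by a path with two arcs. -/
theorem exists_min_outDegree [Finite V] [Nonempty V] {arc : V → V → Prop}
    (hT : IsTournament arc) :
    ∃ z, ∀ u, arc z u → ∃ w, arc u w ∧ arc w z := by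
  classical
  have := Fintype.ofFinite V
  obtain ⟨z, -, hz⟩ := Finset.exists_min_image Finset.univ
    (fun x => (Finset.univ.filter (arc x)).card) Finset.univ_nonempty
  refine ⟨z, fun u hu => ?_⟩
  by_contra! hno
  refine absurd (hz u (Finset.mem_univ u)) (not_le.2 (Finset.card_lt_card ?_))
  rw [Finset.ssubset_iff_of_subset]
  · exact ⟨u, by simp [hu], by simp [hT.1 u]⟩
  · intro w hw
    simp only [Finset.mem_filter, Finset.mem_univ, true_and] at hw ⊢
    refine hT.arc_of_not ?_ (hno w hw)
    rintro rfl
    exact hT.asymm hu hw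

/-- A vertex of maximum out-degree within a set reaches each of its in-neighbours in the set by
a path with two arcs. -/
theorem exists_max_outDegree [Finite V] {arc : V → V → Prop} (hT : IsTournament arc)
    {S : Set V} (hS : S.Nonempty) :
    ∃ p ∈ S, ∀ x ∈ S, arc x p → ∃ u, arc p u ∧ arc u x := by
  classical
  have := Fintype.ofFinite V
  obtain ⟨p, hp, hmax⟩ := Finset.exists_max_image S.toFinset
    (fun x => (S.toFinset.filter (arc x)).card) (by simpa using hS)
  refine ⟨p, by simpa using hp, fun x hx hxp => ?_⟩
  by_contra! hno
  refine absurd (hmax x (by simpa using hx)) (not_le.2 (Finset.card_lt_card ?_))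
  rw [Finset.ssubset_iff_of_subset]
  · exact ⟨p, by simp_all, by simp [hT.1 p]⟩
  · intro w hw
    simp only [Finset.mem_filter] at hw ⊢
    refine ⟨hw.1, hT.arc_of_not ?_ (hno w hw.2)⟩
    rintro rfl
    exact hT.asymm hxp hw.2

/-- Whether `x` has an arc to the `i`-th vertex of the path `v 0, …, v k`, with the convention
that every vertex has arcs to the positions before the path and none to those after it. -/
def pathProfile (arc : V → V → Prop) (v : ℕ → V) (k : ℕ) (x : V) (i : ℤ) : Prop :=
  i < 0 ∨ ∃ n : ℕ, (n : ℤ) = i ∧ n ≤ k ∧ arc x (v n)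

theorem pathProfile_natCast {arc : V → V → Prop} {v : ℕ → V} {k n : ℕ} (hn : n ≤ k) {x : V} :
    pathProfile arc v k x n ↔ arc x (v n) := by
  constructor
  · rintro (h | ⟨m, hm, -, h⟩)
    · omega
    · rwa [← Nat.cast_inj.1 hm]
  · exact fun h => Or.inr ⟨n, rfl, hn, h⟩

theorem not_pathProfile {arc : V → V → Prop} {v : ℕ → V} {k : ℕ} {i : ℤ} (hi : (k : ℤ) < i)
    {x : V} : ¬ pathProfile arc v k x i := by
  rintro (h | ⟨m, hm, hmk, -⟩) <;> omega

theorem pathProfile_of_neg {arc : V → V → Prop} {v : ℕ → V} {k : ℕ} {i : ℤ} (hi : i < 0)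
    {x : V} : pathProfile arc v k x i :=
  Or.inl hi

/-- A light tournament all of whose vertices can be reached from a suitable vertex has a
partition into four classes without directed triangles. -/
theorem Light.exists_coloring_of_reachable [Finite V] {arc : V → V → Prop}
    (hT : IsTournament arc) (hL : Light arc) {z : V}
    (hz : ∀ u, arc z u → ∃ w, arc u w ∧ arc w z) (hreach : ∀ x, ∃ n, x ∈ walkEnds arc z n) :
    ∃ f : V → ZMod 4, ∀ a b c, f a = f b → f b = f c → ¬ Triangle arc a b c := by
  obtain ⟨ℓ, hℓ0, hpred, hstep⟩ := exists_layering arc z hreach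
  have hlayer : ∀ x y, ℓ y + 2 ≤ ℓ x → arc x y := by
    intro x y h
    refine hT.arc_of_not (by rintro rfl; omega) fun hyx => ?_
    have := hstep y x hyx
    omega
  have : Nonempty V := ⟨z⟩
  obtain ⟨q, hq⟩ := Finite.exists_max ℓ
  obtain ⟨k, hk⟩ : ∃ k, ℓ q = k := ⟨_, rfl⟩
  rw [hk] at hq
  obtain ⟨p, hp, hking⟩ := exists_max_outDegree hT (S := {x | ℓ x = k}) ⟨q, hk⟩
  have hp' : ℓ p = k := hp
  obtain ⟨v, hvk, hvl, hva⟩ := exists_layered_path hpred k p hp'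
  have hback : ∀ i j, i + 2 ≤ j → j ≤ k → arc (v j) (v i) := by
    intro i j hij hj
    apply hlayer
    rw [hvl i (by omega), hvl j hj]
    exact hij
  have hdom : ∀ x, arc x p → ∃ u, arc p u ∧ arc u x := by
    intro x hxp
    have h1 := hstep x p hxp
    rcases Nat.lt_or_ge (ℓ x) k with hlt | hge
    · by_cases hx0 : ℓ x = 0
      · rw [hℓ0] at hx0
        subst hx0
        exact hz p hxp
      · obtain ⟨u, hux, hu⟩ := hpred x hx0
        exact ⟨u, hlayer p u (by omega), hux⟩
    · exact hking x (le_antisymm (hq x) hge) hxp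
  have hcomp : ∀ n : ℕ, n < k → ∀ x, pathProfile arc v k x n → ¬ pathProfile arc v k x (n + 1) →
      Completes arc (v n) (v (n + 1)) x := by
    intro n hn x h1 h2
    rw [pathProfile_natCast hn.le] at h1
    rw [← Nat.cast_succ, pathProfile_natCast hn] at h2
    refine ⟨hva n hn, hT.arc_of_not ?_ h2, h1⟩
    rintro rfl
    exact hT.asymm h1 (hva n hn)
  refine exists_coloring_of_profile (fun x y => hT.asymm) (fun x => ℓ x) (pathProfile arc v k)
    (fun x y h => hlayer x y (by omega)) (fun x i h => ?_) (fun x i h => ?_) ?_ ?_ ?_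
  · rcases lt_or_ge i 0 with hi | hi
    · exact pathProfile_of_neg hi
    · lift i to ℕ using hi
      have := hq x
      have hik : i ≤ k := by omega
      rw [pathProfile_natCast hik]
      exact hlayer _ _ (by rw [hvl i hik]; omega)
  · have hi : 0 ≤ i := by omega
    lift i to ℕ using hi
    rcases Nat.lt_or_ge k i with hik | hik
    · exact not_pathProfile (by omega)
    · rw [pathProfile_natCast hik]
      exact hT.asymm (hlayer _ _ (by rw [hvl i hik]; omega))
  · intro i a b c ha hb hc htri
    rcases lt_or_ge i 0 with hi | hi
    · rcases lt_or_ge i (-1) with hi' | hi'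
      · exact ha.2 (pathProfile_of_neg (by omega))
      · obtain rfl : i = -1 := by omega
        have hv0 : v 0 = z := (hℓ0 _).1 (hvl 0 (Nat.zero_le k))
        have hout : ∀ x y, arc y x → ¬ pathProfile arc v k x (-1 + 1) →
            ¬ pathProfile arc v k y (-1 + 1) → arc z x := by
          intro x y hyx hx hy
          have h0 : (-1 + 1 : ℤ) = ((0 : ℕ) : ℤ) := by norm_num
          rw [h0, pathProfile_natCast (Nat.zero_le k), hv0] at hx hy
          refine hT.arc_of_not ?_ hx
          rintro rfl
          exact hy hyx
        have hza := hout a c htri.2.2 ha.2 hc.2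
        have hzb := hout b a htri.1 hb.2 ha.2
        have hzc := hout c b htri.2.1 hc.2 hb.2
        exact hL.not_triangle_of_dominating hT hza hzb hzc (hz a hza) (hz b hzb) (hz c hzc) htri
    · lift i to ℕ using hi
      rcases lt_trichotomy i k with hik | rfl | hik
      · exact hL.not_triangle_of_completes (hcomp i hik a ha.1 ha.2) (hcomp i hik b hb.1 hb.2)
          (hcomp i hik c hc.1 hc.2) htri
      · rw [pathProfile_natCast le_rfl, hvk] at ha hb hc
        exact hL.not_triangle_of_dominated hT ha.1 hb.1 hc.1 (hdom a ha.1) (hdom b hb.1)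
          (hdom c hc.1) htri
      · exact not_pathProfile (by omega) ha.1
  · intro i a m b heven ha ha3 hm hm3 hb hb1 hb3 htri
    have hi : 0 ≤ i := by
      by_contra! hneg
      refine ha.2 (pathProfile_of_neg ?_)
      obtain ⟨j, rfl⟩ := heven
      omega
    lift i to ℕ using hi
    have hik : i + 3 ≤ k := by
      by_contra! h
      exact not_pathProfile (by omega) hm3.1
    have ha' := hcomp i (by omega) a ha.1 ha.2
    have hm' := hcomp i (by omega) m hm.1 hm.2
    have hc3 : ((i : ℤ) + 3) = ((i + 3 : ℕ) : ℤ) := by push_cast; ring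
    have hc4 : ((i : ℤ) + 4) = ((i + 3 : ℕ) : ℤ) + 1 := by push_cast; ring
    rw [hc4, hc3] at hm3 hb3
    rcases hik.lt_or_eq with hlt | heq
    · exact hL a m b htri ⟨_, _, ha', hm'⟩
        ⟨_, _, hcomp _ hlt m hm3.1 hm3.2, hcomp _ hlt b hb3.1 hb3.2⟩
    · rw [hc3, pathProfile_natCast hik, heq, hvk] at ha3
      have hmp := (pathProfile_natCast hik).1 hm3.1
      have hbp := (pathProfile_natCast hik).1 hb3.1
      rw [← Nat.cast_succ, pathProfile_natCast (by omega)] at hb1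
      have hpr := hback (i + 1) k (by omega) le_rfl
      rw [heq, hvk] at hmp hbp
      rw [hvk] at hpr
      have hpa : arc p a := by
        refine hT.arc_of_not ?_ ha3
        rintro rfl
        exact hT.asymm hpr ha'.2.1
      obtain ⟨u, hpu, hub⟩ := hdom b hbp
      exact hL.not_triangle_of_path_end hT hpr ha' hm' hpa hmp hb1 hbp hpu hub htri
  · intro i a b ha0 ha1 ha2 hb0 hb1 hb2 hab
    have hi : 0 ≤ i := by
      by_contra! hneg
      exact ha0 (pathProfile_of_neg hneg)
    lift i to ℕ using hi
    have hik : i + 2 ≤ k := by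
      by_contra! h
      exact not_pathProfile (by omega) hb2
    have hc1 : ((i : ℤ) + 1) = ((i + 1 : ℕ) : ℤ) := by push_cast; ring
    have hc2 : ((i : ℤ) + 2) = ((i + 2 : ℕ) : ℤ) := by push_cast; ring
    rw [hc1, pathProfile_natCast (by omega)] at ha1 hb1
    rw [hc2, pathProfile_natCast (by omega)] at ha2 hb2
    rw [pathProfile_natCast (by omega)] at ha0 hb0
    have h01 := hva i (by omega)
    have h12 := hva (i + 1) (by omega)
    have h20 := hback i (i + 2) le_rfl hik
    have h0a : arc (v i) a := hT.arc_of_not (by rintro rfl; exact ha1 h01) ha0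
    have h1a : arc (v (i + 1)) a := hT.arc_of_not (by rintro rfl; exact ha2 h12) ha1
    have h2a : arc (v (i + 2)) a := hT.arc_of_not (by rintro rfl; exact ha0 h20) ha2
    exact hL.not_triangle_of_completes ⟨hab, hb0, h0a⟩ ⟨hab, hb1, h1a⟩ ⟨hab, hb2, h2a⟩
      ⟨h01, h12, h20⟩

theorem IsTournament.comap {W : Type*} {arc : V → V → Prop} (hT : IsTournament arc) {g : W → V}
    (hg : Function.Injective g) : IsTournament (fun a b => arc (g a) (g b)) :=
  ⟨fun _ => hT.1 _, fun _ _ hab => hT.2 _ _ (hg.ne hab)⟩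

theorem Light.comap {W : Type*} {arc : V → V → Prop} (hL : Light arc) (g : W → V) :
    Light (fun a b => arc (g a) (g b)) := by
  rintro a b c h ⟨s, t, h1, h2⟩ ⟨s', t', h3, h4⟩
  exact hL (g a) (g b) (g c) h ⟨g s, g t, h1, h2⟩ ⟨g s', g t', h3, h4⟩

theorem Light.exists_coloring_of_card_le (n : ℕ) :
    ∀ {V : Type*} [Finite V] {arc : V → V → Prop},
    Nat.card V ≤ n → IsTournament arc → Light arc →
    ∃ f : V → ZMod 4, ∀ a b c, f a = f b → f b = f c → ¬ Triangle arc a b c := by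
  induction n with
  | zero =>
    intro V _ arc hn _ _
    have : IsEmpty V := (Nat.card_eq_zero.1 (Nat.le_zero.1 hn)).resolve_right (by simpa)
    exact ⟨isEmptyElim, fun a => isEmptyElim a⟩
  | succ n ih =>
    intro V _ arc hn hT hL
    classical
    rcases isEmpty_or_nonempty V with hV | hV
    · exact ⟨isEmptyElim, fun a => isEmptyElim a⟩
    obtain ⟨z, hz⟩ := exists_min_outDegree hT
    set R : Set V := {x | ∃ n, x ∈ walkEnds arc z n}
    have hzR : z ∈ R := ⟨0, rfl⟩
    by_cases hall : ∀ x, x ∈ R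
    · exact hL.exists_coloring_of_reachable hT hz hall
    push Not at hall
    obtain ⟨y, hy⟩ := hall
    have hclosed : ∀ a b, arc a b → a ∈ R → b ∈ R := fun a b hab ⟨m, hm⟩ => ⟨m + 1, a, hm, hab⟩
    have hcard : ∀ (S : Set V) (x : V), x ∉ S → Nat.card S ≤ n := by
      intro S x hx
      have : Nat.card S < Nat.card V := by
        rw [Nat.card_coe_set_eq]
        exact Set.ncard_lt_card fun h => hx (h ▸ Set.mem_univ x)
      omega
    obtain ⟨f, hf⟩ := ih (hcard R y hy) (hT.comap Subtype.val_injective) (hL.comap _)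
    obtain ⟨g, hg⟩ := ih (hcard Rᶜ z (by simpa using hzR)) (hT.comap Subtype.val_injective)
      (hL.comap _)
    refine ⟨fun x => if h : x ∈ R then f ⟨x, h⟩ else g ⟨x, h⟩, fun a b c hab hbc htri => ?_⟩
    by_cases ha : a ∈ R
    · have hb := hclosed a b htri.1 ha
      have hc := hclosed b c htri.2.1 hb
      simp only [ha, hb, hc, dite_true] at hab hbc
      exact hf _ _ _ hab hbc htri
    · have hc : c ∉ R := fun hc => ha (hclosed c a htri.2.2 hc)
      have hb : b ∉ R := fun hb => hc (hclosed b c htri.2.1 hb)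
      simp only [ha, hb, hc, dite_false] at hab hbc
      exact hg _ _ _ hab hbc htri

/-- Every light tournament has a partition into four classes without directed triangles. -/
theorem Light.exists_coloring [Finite V] {arc : V → V → Prop} (hT : IsTournament arc)
    (hL : Light arc) :
    ∃ f : V → ZMod 4, ∀ a b c, f a = f b → f b = f c → ¬ Triangle arc a b c :=
  Light.exists_coloring_of_card_le _ le_rfl hT hL

/-- A light tournament has a feedback vertex set of weight at most `7/3` times the value of any
fractional triangle transversal. -/
theorem exists_fvs_of_light [DecidableEq V] {arc : V → V → Prop} (hT : IsTournament arc)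
    {w : V → ℝ} (hw : ∀ v, 0 ≤ w v) (S : Finset V) (hL : Light (fun a b : S => arc a b)) (x : V → ℝ)
    (hx0 : ∀ v ∈ S, 0 ≤ x v)
    (hx : ∀ a ∈ S, ∀ b ∈ S, ∀ c ∈ S, Triangle arc a b c → 1 ≤ x a + x b + x c) :
    ∃ X ⊆ S, (∀ a ∈ S \ X, ∀ b ∈ S \ X, ∀ c ∈ S \ X, ¬ Triangle arc a b c) ∧
      ∑ v ∈ X, w v ≤ 7 / 3 * ∑ v ∈ S, w v * x v := by
  induction S using Finset.strongInduction generalizing x with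
  | H S ih =>
  have hlight : ∀ v ∈ S, Light (fun a b : (S.erase v : Finset V) => arc a b) := fun v _ =>
    hL.comap fun a : (S.erase v : Finset V) => (⟨a, Finset.mem_of_mem_erase a.2⟩ : S)
  have htake : ∀ x : V → ℝ, (∀ v ∈ S, 0 ≤ x v) →
      (∀ a ∈ S, ∀ b ∈ S, ∀ c ∈ S, Triangle arc a b c → 1 ≤ x a + x b + x c) →
      (∃ v ∈ S, 3 / 7 ≤ x v) →
      ∃ X ⊆ S, (∀ a ∈ S \ X, ∀ b ∈ S \ X, ∀ c ∈ S \ X, ¬ Triangle arc a b c) ∧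
      ∑ v ∈ X, w v ≤ 7 / 3 * ∑ v ∈ S, w v * x v := by
    rintro x hx0 hx ⟨v, hv, hxv⟩
    obtain ⟨X, hXS, hX, hwX⟩ := ih (S.erase v) (Finset.erase_ssubset hv) (hlight v hv) x
      (fun u hu => hx0 u (Finset.mem_of_mem_erase hu))
      (fun a ha b hb c hc => hx a (Finset.mem_of_mem_erase ha) b (Finset.mem_of_mem_erase hb) c
        (Finset.mem_of_mem_erase hc))
    have hvX : v ∉ X := fun h => Finset.notMem_erase v S (hXS h)
    refine ⟨insert v X, Finset.insert_subset hv (hXS.trans (Finset.erase_subset _ _)), ?_, ?_⟩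
    · have : S \ insert v X = S.erase v \ X := by
        ext u
        simp only [Finset.mem_sdiff, Finset.mem_insert, Finset.mem_erase]
        tauto
      rwa [this]
    · rw [Finset.sum_insert hvX, ← Finset.add_sum_erase S _ hv]
      nlinarith [mul_le_mul_of_nonneg_left hxv (hw v)]
  by_cases hbig : ∃ v ∈ S, 3 / 7 ≤ x v
  · exact htake x hx0 hx hbig
  by_cases hfree : ∃ v ∈ S, ∀ b ∈ S, ∀ c ∈ S, ¬ Triangle arc v b c
  · obtain ⟨v, hv, hvfree⟩ := hfree
    obtain ⟨X, hXS, hX, hwX⟩ := ih (S.erase v) (Finset.erase_ssubset hv) (hlight v hv) x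
      (fun u hu => hx0 u (Finset.mem_of_mem_erase hu))
      (fun a ha b hb c hc => hx a (Finset.mem_of_mem_erase ha) b (Finset.mem_of_mem_erase hb) c
        (Finset.mem_of_mem_erase hc))
    refine ⟨X, hXS.trans (Finset.erase_subset _ _), fun a ha b hb c hc h => ?_, ?_⟩
    · simp only [Finset.mem_sdiff] at ha hb hc
      by_cases hav : a = v
      · exact hvfree b hb.1 c hc.1 (hav ▸ h)
      by_cases hbv : b = v
      · exact hvfree c hc.1 a ha.1 (hbv ▸ h.rotate)
      by_cases hcv : c = v
      · exact hvfree a ha.1 b hb.1 (hcv ▸ h.rotate.rotate)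
      refine hX a ?_ b ?_ c ?_ h <;> simp [*]
    · rw [← Finset.add_sum_erase S _ hv]
      nlinarith [mul_nonneg (hw v) (hx0 v hv)]
  push Not at hbig hfree
  by_cases hsum : ∑ v ∈ S, w v ≤ 3 * ∑ v ∈ S, w v * x v
  · obtain ⟨f, hf⟩ := hL.exists_coloring (hT.comap Subtype.val_injective)
    set g : V → ZMod 4 := fun v => if h : v ∈ S then f ⟨v, h⟩ else 0 with hg
    obtain ⟨i, -, hi⟩ : ∃ i ∈ (Finset.univ : Finset (ZMod 4)),
        (∑ v ∈ S, w v) / 4 ≤ ∑ v ∈ S with g v = i, w v := by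
      refine Finset.exists_le_of_sum_le Finset.univ_nonempty (le_of_eq ?_)
      rw [Finset.sum_fiberwise, Finset.sum_const, Finset.card_univ, ZMod.card, nsmul_eq_mul]
      push_cast
      ring
    refine ⟨S.filter (fun v => ¬ g v = i), Finset.filter_subset _ _,
      fun a ha b hb c hc h => ?_, ?_⟩
    · simp only [Finset.mem_sdiff, Finset.mem_filter, not_and, not_not] at ha hb hc
      have ha' := ha.2 ha.1
      have hb' := hb.2 hb.1
      have hc' := hc.2 hc.1
      simp only [hg, ha.1, hb.1, hc.1, dite_true] at ha' hb' hc'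
      exact hf ⟨a, ha.1⟩ ⟨b, hb.1⟩ ⟨c, hc.1⟩ (ha'.trans hb'.symm) (hb'.trans hc'.symm) h
    · have hsplit := Finset.sum_filter_add_sum_filter_not S (fun v => g v = i) w
      have hpos : 0 ≤ ∑ v ∈ S, w v * x v :=
        Finset.sum_nonneg fun v hv => mul_nonneg (hw v) (hx0 v hv)
      linarith
  · push Not at hsum
    have hne : S.Nonempty := by
      rw [Finset.nonempty_iff_ne_empty]
      rintro rfl
      simp at hsum
    obtain ⟨u, hu, hmin⟩ := Finset.exists_min_image S x hne
    have hu3 : x u < 1 / 3 := by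
      by_contra! h
      refine absurd hsum (not_lt.2 ?_)
      rw [Finset.mul_sum]
      exact Finset.sum_le_sum fun v hv => by nlinarith [hw v, hmin v hv]
    have hden : 0 < 1 - 3 * x u := by linarith
    set y : V → ℝ := fun v => (x v - x u) / (1 - 3 * x u) with hy
    have hy0 : ∀ v ∈ S, 0 ≤ y v := fun v hv =>
      div_nonneg (sub_nonneg.2 (hmin v hv)) hden.le
    have hytri : ∀ a ∈ S, ∀ b ∈ S, ∀ c ∈ S, Triangle arc a b c → 1 ≤ y a + y b + y c := by
      intro a ha b hb c hc h
      simp only [hy, ← add_div]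
      rw [le_div_iff₀ hden]
      linarith [hx a ha b hb c hc h]
    have hycost : ∑ v ∈ S, w v * y v ≤ ∑ v ∈ S, w v * x v := by
      have : ∑ v ∈ S, w v * y v =
          (∑ v ∈ S, w v * x v - x u * ∑ v ∈ S, w v) / (1 - 3 * x u) := by
        rw [Finset.mul_sum, ← Finset.sum_sub_distrib, Finset.sum_div]
        exact Finset.sum_congr rfl fun v _ => by simp only [hy]; ring
      rw [this, div_le_iff₀ hden]
      nlinarith [mul_le_mul_of_nonneg_left hsum.le (hx0 u hu)]
    obtain ⟨b, hb, c, hc, h⟩ := hfree u hu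
    have hyu : y u = 0 := by simp [hy]
    have h1 := hytri u hu b hb c hc h
    have hlarge : ∃ v ∈ S, 3 / 7 ≤ y v := by
      by_contra! hlt
      linarith [hlt b hb, hlt c hc]
    obtain ⟨X, hXS, hX, hwX⟩ := htake y hy0 hytri hlarge
    exact ⟨X, hXS, hX, hwX.trans (by linarith)⟩

/-- If all variables of a feasible point of the relaxation are less than `3/7` on a set of
vertices, then the set induces a light tournament. -/
theorem SA1Feasible.light {arc : V → V → Prop} (hT : IsTournament arc) {x : V → ℝ}
    {y : V → V → ℝ} (h : SA1Feasible arc x y) {S : Finset V} (hS : ∀ v ∈ S, x v < 3 / 7) :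
    Light (fun a b : S => arc a b) := by
  obtain ⟨hsymm, -, htri, htri', -⟩ := h
  have hdiag : ∀ u v : S, u ≠ v → Diagonal (fun a b : S => arc a b) u v → 1 / 7 < y u v := by
    rintro u v huv ⟨s, t, ⟨h1, h2, h3⟩, -, h5, h6⟩
    have hvs : (v : V) ≠ s := fun h => hT.1 s (by simpa [h] using h6)
    have hvt : (v : V) ≠ t := fun h => hT.1 t (by simpa [h] using h5)
    have e1 := (htri' s t u v ⟨h1, h2, h3⟩ hvs hvt fun h => huv (Subtype.ext h.symm)).1
    have e2 := htri t v s ⟨h5, h6, h1⟩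
    have e3 := hsymm v s
    linarith [hS s s.2, hS t t.2]
  rintro a b c ⟨h1, h2, h3⟩ hab hbc
  have e1 := hdiag a b (by rintro rfl; exact hT.1 _ h1) hab
  have e2 := hdiag b c (by rintro rfl; exact hT.1 _ h2) hbc
  have e3 := htri a b c ⟨h1, h2, h3⟩
  linarith [hS a a.2, hS b b.2, hS c c.2]

/-- Each feasible point of the relaxation can be rounded to a feedback vertex set, at the cost
of a factor `7/3`. -/
theorem SA1Feasible.exists_fvs [DecidableEq V] {arc : V → V → Prop} (hT : IsTournament arc)
    {x : V → ℝ} {y : V → V → ℝ} (h : SA1Feasible arc x y) {w : V → ℝ} (hw : ∀ v, 0 ≤ w v)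
    (S : Finset V) :
    ∃ X ⊆ S, (∀ a ∈ S \ X, ∀ b ∈ S \ X, ∀ c ∈ S \ X, ¬ Triangle arc a b c) ∧
      ∑ v ∈ X, w v ≤ 7 / 3 * ∑ v ∈ S, w v * x v := by
  induction S using Finset.strongInduction with
  | H S ih =>
  by_cases hbig : ∃ v ∈ S, 3 / 7 ≤ x v
  · obtain ⟨v, hv, hxv⟩ := hbig
    obtain ⟨X, hXS, hX, hwX⟩ := ih (S.erase v) (Finset.erase_ssubset hv)
    have hvX : v ∉ X := fun h => Finset.notMem_erase v S (hXS h)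
    refine ⟨insert v X, Finset.insert_subset hv (hXS.trans (Finset.erase_subset _ _)), ?_, ?_⟩
    · have : S \ insert v X = S.erase v \ X := by
        ext u
        simp only [Finset.mem_sdiff, Finset.mem_insert, Finset.mem_erase]
        tauto
      rwa [this]
    · rw [Finset.sum_insert hvX, ← Finset.add_sum_erase S _ hv]
      nlinarith [mul_le_mul_of_nonneg_left hxv (hw v)]
  · push Not at hbig
    refine exists_fvs_of_light hT hw S (h.light hT hbig) x (fun v _ => (h.2.1 v).1)
      fun a _ b _ c _ habc => ?_
    have hab : a ≠ b := by rintro rfl; exact hT.1 _ habc.1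
    have hbc : b ≠ c := by rintro rfl; exact hT.1 _ habc.2.1
    linarith [h.2.2.1 a b c habc, (h.2.2.2.2 a b hab).2, (h.2.2.2.2 b c hbc).2]

open Classical in
/-- The characteristic vector of a feedback vertex set is feasible for the relaxation. -/
theorem IsFVS.sa1Feasible {arc : V → V → Prop} {Y : Finset V} (hY : IsFVS arc (↑Y : Set V)) :
    SA1Feasible arc (fun v => if v ∈ Y then 1 else 0)
      (fun a b => (if a ∈ Y then 1 else 0) * if b ∈ Y then 1 else 0) := by
  have htri : ∀ a b c, Triangle arc a b c → a ∈ Y ∨ b ∈ Y ∨ c ∈ Y := by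
    intro a b c h
    by_contra! hno
    exact hY a b c (by simpa using hno.1) (by simpa using hno.2.1) (by simpa using hno.2.2) h
  refine ⟨fun a b => mul_comm _ _, fun a => ?_, fun a b c h => ?_, fun a b c d h _ _ _ => ?_,
    fun a b _ => ?_⟩
  · by_cases ha : a ∈ Y <;> norm_num [ha]
  · have := htri a b c h
    by_cases ha : a ∈ Y <;> by_cases hb : b ∈ Y <;> by_cases hc : c ∈ Y <;> simp_all
  · have := htri a b c h
    by_cases ha : a ∈ Y <;> by_cases hb : b ∈ Y <;> by_cases hc : c ∈ Y <;>
      by_cases hd : d ∈ Y <;> simp_all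
  · by_cases ha : a ∈ Y <;> by_cases hb : b ∈ Y <;> norm_num [ha, hb]

/-- For every tournament `T` and nonnegative weights `w`, there is a feedback
vertex set `X` with `w(X) ≤ (7/3)·SA₁(T,w)`; in particular
`w(X) ≤ (7/3)·OPT(T,w)`, i.e. `w(X) ≤ (7/3)·w(Y)` for every feedback vertex set `Y`. -/
theorem stmt0 [Fintype V] (arc : V → V → Prop) (hT : IsTournament arc)
    (w : V → ℚ) (hw : ∀ v, 0 ≤ w v) :
    ∃ X : Finset V, IsFVS arc (↑X : Set V) ∧
      (∑ v ∈ X, (w v : ℝ)) ≤ 7 / 3 * SA1Val arc w ∧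
      ∀ Y : Finset V, IsFVS arc (↑Y : Set V) →
        (∑ v ∈ X, (w v : ℝ)) ≤ 7 / 3 * ∑ v ∈ Y, (w v : ℝ) := by
  classical
  have hw' : ∀ v, (0 : ℝ) ≤ w v := fun v => by exact_mod_cast hw v
  obtain ⟨X, hX, hmin⟩ := Finset.exists_min_image
    (Finset.univ.filter fun X : Finset V => IsFVS arc (↑X : Set V))
    (fun X => ∑ v ∈ X, (w v : ℝ))
    ⟨Finset.univ, by simp [IsFVS]⟩
  have hround : ∀ x y, SA1Feasible arc x y →
      ∑ v ∈ X, (w v : ℝ) ≤ 7 / 3 * ∑ v, (w v : ℝ) * x v := by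
    intro x y hxy
    obtain ⟨Z, -, hZ, hwZ⟩ := hxy.exists_fvs hT hw' Finset.univ
    refine (hmin Z ?_).trans hwZ
    simp only [Finset.mem_filter, Finset.mem_univ, true_and]
    exact fun a b c ha hb hc => hZ a (by simpa using ha) b (by simpa using hb) c (by simpa using hc)
  have hFVS : IsFVS arc (↑X : Set V) := (Finset.mem_filter.1 hX).2
  refine ⟨X, hFVS, ?_, fun Y hY => ?_⟩
  · have : (∑ v ∈ X, (w v : ℝ)) * (3 / 7) ≤ SA1Val arc w := by
      refine le_csInf ⟨_, _, _, hFVS.sa1Feasible, rfl⟩ ?_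
      rintro t ⟨x, y, hxy, rfl⟩
      linarith [hround x y hxy]
    linarith
  · simpa using hround _ _ hY.sa1Feasible
end

section
/- Let T be a tournament and let x ∈ SA₁(T). If x_v < 3/7 for every vertex v of T, then T is light. -/
variable {V : Type*}

/-- The pair `{a,b}` is a diagonal: there are `u, v` such that both `{u,v,a}` and
`{u,v,b}` are triangles. -/
def IsDiagonal (arc : V → V → Prop) (a b : V) : Prop :=
  ∃ u v : V, Triangle arc u v a ∧ Triangle arc u v b

/-- A heavy triangle: a triangle at least two of whose vertex pairs are diagonals. -/
def HeavyTriangle (arc : V → V → Prop) (a b c : V) : Prop :=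
  Triangle arc a b c ∧
  ((IsDiagonal arc a b ∧ IsDiagonal arc b c) ∨
   (IsDiagonal arc a b ∧ IsDiagonal arc a c) ∨
   (IsDiagonal arc b c ∧ IsDiagonal arc a c))

/-- A tournament is heavy if it contains a heavy triangle. -/
def IsHeavy (arc : V → V → Prop) : Prop := ∃ a b c : V, HeavyTriangle arc a b c

/-- A tournament is light if it is not heavy. -/
def IsLight (arc : V → V → Prop) : Prop := ¬ IsHeavy arc

/-- If all vertex variables are below `3/7`, the lift exceeds `1/7` on every diagonal. -/
theorem IsDiagonal.one_div_seven_lt {arc : V → V → Prop} (hirr : ∀ v, ¬ arc v v)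
    {x : V → ℝ} {y : V → V → ℝ} (hxy : SA1Feasible arc x y) (hx : ∀ v, x v < 3 / 7)
    {a b : V} (hab : a ≠ b) (h : IsDiagonal arc a b) : 1 / 7 < y a b := by
  obtain ⟨u, v, ha, hb⟩ := h
  obtain ⟨hsymm, -, htri, hquad, -⟩ := hxy
  have hbu : b ≠ u := by
    rintro rfl
    exact hirr _ hb.2.2
  have hbv : b ≠ v := by
    rintro rfl
    exact hirr _ hb.2.1
  have h₁ := (hquad u v a b ha hbu hbv hab.symm).1
  have h₂ := htri v b u hb.rotate
  linarith [hx u, hx v, hsymm b u]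

/-- If `x ∈ SA₁(T)` (witnessed by a lift `y`) satisfies `x_v < 3/7` for every
vertex, then the tournament `T` is light. -/
theorem stmt2 [Fintype V] (arc : V → V → Prop) (hT : IsTournament arc)
    (x : V → ℝ) (y : V → V → ℝ) (hxy : SA1Feasible arc x y)
    (hx : ∀ v, x v < 3 / 7) : IsLight arc := by
  rintro ⟨a, b, c, habc, h⟩
  have ne_of_arc : ∀ {p q : V}, arc p q → p ≠ q := by
    rintro p q hpq rfl
    exact hT.1 _ hpq
  have diag {p q : V} (hpq : p ≠ q) (h : IsDiagonal arc p q) : 1 / 7 < y p q :=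
    h.one_div_seven_lt hT.1 hxy hx hpq
  have hab := ne_of_arc habc.1
  have hbc := ne_of_arc habc.2.1
  have hac := (ne_of_arc habc.2.2).symm
  have hsymm := hxy.1
  have htri := hxy.2.2.1
  have hxa := hx a
  have hxb := hx b
  have hxc := hx c
  rcases h with ⟨h₁, h₂⟩ | ⟨h₁, h₂⟩ | ⟨h₁, h₂⟩
  · linarith [htri a b c habc, diag hab h₁, diag hbc h₂]
  · linarith [htri c a b habc.rotate.rotate, diag hab h₁, diag hac h₂, hsymm a c]
  · linarith [htri b c a habc.rotate, diag hbc h₁, diag hac h₂, hsymm a c]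
end

section
/- Let T be a tournament and let u, v, a, b be vertices such that both {u,v,a} and {u,v,b} are triangles of T (so that {a,b} is a diagonal). If x ∈ ℝ^{V(T)} together with a lift (x_{pq}) over unordered pairs satisfies the constraints of SA₁(T), then x_u + x_v + x_{ab} ≥ 1. In particular, if moreover x_p < 3/7 for all vertices p, then x_{ab} ≥ 1/7. -/
variable {V : Type*}

/-- If `{u,v,a}` and `{u,v,b}` are both triangles (so `{a,b}` is a diagonal) and
`(x, y)` satisfies the constraints of `SA₁(T)`, then `x_u + x_v + x_{ab} ≥ 1`;
in particular, if `x_p < 3/7` for all vertices `p`, then `x_{ab} ≥ 1/7`. -/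
theorem stmt3 [Fintype V] (arc : V → V → Prop) (hT : IsTournament arc)
    (u v a b : V) (hab : a ≠ b)
    (h1 : Triangle arc u v a) (h2 : Triangle arc u v b)
    (x : V → ℝ) (y : V → V → ℝ) (hxy : SA1Feasible arc x y) :
    1 ≤ x u + x v + y a b ∧ ((∀ p, x p < 3 / 7) → 1 / 7 ≤ y a b) := by
  obtain ⟨hsymm, -, htri, hlift, -⟩ := hxy
  have hbu : b ≠ u := fun h => hT.1 u (h ▸ h2.2.2)
  have hbv : b ≠ v := fun h => hT.1 v (h ▸ h2.2.1)
  have hcover := (hlift u v a b h1 hbu hbv hab.symm).1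
  have hmiddle := htri v b u ⟨h2.2.1, h2.2.2, h2.1⟩
  rw [hsymm b u] at hmiddle
  have hsum : 1 ≤ x u + x v + y a b := by linarith
  exact ⟨hsum, fun hx => by linarith [hx u, hx v]⟩
end

section
/- Let S be a tournament on five vertices {z, u₁, u₂, v₁, v₂} containing the arcs (u₁,z), (u₂,z), (z,v₁), (z,v₂), (v₁,u₁), (v₂,u₂), (u₁,v₂), (u₂,v₁) (the arcs between u₁,u₂ and between v₁,v₂ are oriented arbitrarily). Then either S is heavy, or there exists i ∈ {1,2} such that both (u_i, u_{3−i}) and (v_i, v_{3−i}) are arcs of S. -/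
variable {V : Type*}

/-- A tournament is heavy if some arc `p → q` forms a triangle with each vertex of a triangle. -/
theorem isHeavy_of_common_arc {arc : V → V → Prop} {a b c p q : V} (habc : Triangle arc a b c)
    (ha : Triangle arc p q a) (hb : Triangle arc p q b) (hc : Triangle arc p q c) :
    IsHeavy arc :=
  ⟨a, b, c, habc, Or.inl ⟨⟨p, q, ha, hb⟩, ⟨p, q, hb, hc⟩⟩⟩

/-- Any tournament on the five vertices `{z, u₁, u₂, v₁, v₂}` containing the arcs
`(u₁,z), (u₂,z), (z,v₁), (z,v₂), (v₁,u₁), (v₂,u₂), (u₁,v₂), (u₂,v₁)` is either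
heavy, or there is `i ∈ {1,2}` with both `(u_i, u_{3-i})` and `(v_i, v_{3-i})` arcs. -/
theorem stmt4 [Fintype V] (arc : V → V → Prop) (hT : IsTournament arc)
    (z u₁ u₂ v₁ v₂ : V)
    (hdist : ([z, u₁, u₂, v₁, v₂] : List V).Pairwise (· ≠ ·))
    (huniv : ∀ x : V, x = z ∨ x = u₁ ∨ x = u₂ ∨ x = v₁ ∨ x = v₂)
    (h1 : arc u₁ z) (h2 : arc u₂ z) (h3 : arc z v₁) (h4 : arc z v₂)
    (h5 : arc v₁ u₁) (h6 : arc v₂ u₂) (h7 : arc u₁ v₂) (h8 : arc u₂ v₁) :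
    IsHeavy arc ∨ (arc u₁ u₂ ∧ arc v₁ v₂) ∨ (arc u₂ u₁ ∧ arc v₂ v₁) := by
  have hu : u₁ ≠ u₂ := by simp_all
  have hv : v₁ ≠ v₂ := by simp_all
  by_cases hu₁₂ : arc u₁ u₂ <;> by_cases hv₁₂ : arc v₁ v₂
  · exact Or.inr (Or.inl ⟨hu₁₂, hv₁₂⟩)
  · have hv₂₁ : arc v₂ v₁ := (hT.2 v₂ v₁ hv.symm).2 hv₁₂
    exact Or.inl (isHeavy_of_common_arc (p := v₁) (q := u₁)
      ⟨h4, h6, h2⟩ ⟨h5, h1, h3⟩ ⟨h5, h7, hv₂₁⟩ ⟨h5, hu₁₂, h8⟩)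
  · have hu₂₁ : arc u₂ u₁ := (hT.2 u₂ u₁ hu.symm).2 hu₁₂
    exact Or.inl (isHeavy_of_common_arc (p := v₂) (q := u₂)
      ⟨h3, h5, h1⟩ ⟨h6, h2, h4⟩ ⟨h6, h8, hv₁₂⟩ ⟨h6, hu₂₁, h7⟩)
  · exact Or.inr (Or.inr ⟨(hT.2 u₂ u₁ hu.symm).2 hu₁₂, (hT.2 v₂ v₁ hv.symm).2 hv₁₂⟩)
end

section
/- Let S be a tournament on seven vertices {z, u₁, u₂, u₃, v₁, v₂, v₃} containing the arcs (u_i,z), (z,v_i), (v_i,u_i) for all i ∈ {1,2,3}, and (u_i,v_j) for all i ≠ j (the arcs among {u₁,u₂,u₃} and among {v₁,v₂,v₃} are oriented arbitrarily). Then S is heavy. -/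
variable {V : Type*}

/-- If `u` has an in-neighbour `u'` and `v` has an out-neighbour `v''` among the analogous
vertices, then `z → v → u → z` is a heavy triangle. -/
theorem isHeavy_of_arcs {arc : V → V → Prop} {z u v u' v' u'' v'' : V}
    (hzv : arc z v) (hvu : arc v u) (huz : arc u z)
    (hzv' : arc z v') (hvu' : arc v' u') (huz' : arc u' z)
    (hzv'' : arc z v'') (hvu'' : arc v'' u'') (huz'' : arc u'' z)
    (huv' : arc u v') (huv'' : arc u'' v)
    (hu : arc u' u) (hv : arc v v'') : IsHeavy arc :=
  ⟨z, v, u, ⟨hzv, hvu, huz⟩, Or.inr <| Or.inl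
    ⟨⟨v'', u'', ⟨hvu'', huz'', hzv''⟩, ⟨hvu'', huv'', hv⟩⟩,
      ⟨v', u', ⟨hvu', huz', hzv'⟩, ⟨hvu', hu, huv'⟩⟩⟩⟩

/-- Any tournament on the seven vertices `{z, u₁, u₂, u₃, v₁, v₂, v₃}` containing
the arcs `(u_i, z)`, `(z, v_i)`, `(v_i, u_i)` for all `i`, and `(u_i, v_j)` for all
`i ≠ j`, is heavy. -/
theorem stmt5 [Fintype V] (arc : V → V → Prop) (hT : IsTournament arc)
    (z u₁ u₂ u₃ v₁ v₂ v₃ : V)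
    (hdist : ([z, u₁, u₂, u₃, v₁, v₂, v₃] : List V).Pairwise (· ≠ ·))
    (huniv : ∀ x : V, x = z ∨ x = u₁ ∨ x = u₂ ∨ x = u₃ ∨ x = v₁ ∨ x = v₂ ∨ x = v₃)
    (hu1 : arc u₁ z) (hu2 : arc u₂ z) (hu3 : arc u₃ z)
    (hv1 : arc z v₁) (hv2 : arc z v₂) (hv3 : arc z v₃)
    (hvu1 : arc v₁ u₁) (hvu2 : arc v₂ u₂) (hvu3 : arc v₃ u₃)
    (h12 : arc u₁ v₂) (h13 : arc u₁ v₃) (h21 : arc u₂ v₁) (h23 : arc u₂ v₃)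
    (h31 : arc u₃ v₁) (h32 : arc u₃ v₂) :
    IsHeavy arc := by
  obtain ⟨-, hT⟩ := hT
  simp only [List.pairwise_cons, List.mem_cons, List.not_mem_nil, or_false, forall_eq_or_imp,
    forall_eq] at hdist
  obtain ⟨-, ⟨du12, du13, -⟩, ⟨du23, -⟩, -, ⟨dv12, dv13⟩, dv23, -⟩ := hdist
  have u12 := hT _ _ du12
  have u13 := hT _ _ du13
  have u23 := hT _ _ du23
  have v12 := hT _ _ dv12
  have v13 := hT _ _ dv13
  have v23 := hT _ _ dv23
  by_contra hL
  have h1_2_2 := fun p q => hL <| isHeavy_of_arcs hv1 hvu1 hu1 hv2 hvu2 hu2 hv2 hvu2 hu2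
    h12 h21 p q
  have h1_2_3 := fun p q => hL <| isHeavy_of_arcs hv1 hvu1 hu1 hv2 hvu2 hu2 hv3 hvu3 hu3
    h12 h31 p q
  have h1_3_2 := fun p q => hL <| isHeavy_of_arcs hv1 hvu1 hu1 hv3 hvu3 hu3 hv2 hvu2 hu2
    h13 h21 p q
  have h1_3_3 := fun p q => hL <| isHeavy_of_arcs hv1 hvu1 hu1 hv3 hvu3 hu3 hv3 hvu3 hu3
    h13 h31 p q
  have h2_1_1 := fun p q => hL <| isHeavy_of_arcs hv2 hvu2 hu2 hv1 hvu1 hu1 hv1 hvu1 hu1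
    h21 h12 p q
  have h2_1_3 := fun p q => hL <| isHeavy_of_arcs hv2 hvu2 hu2 hv1 hvu1 hu1 hv3 hvu3 hu3
    h21 h32 p q
  have h2_3_1 := fun p q => hL <| isHeavy_of_arcs hv2 hvu2 hu2 hv3 hvu3 hu3 hv1 hvu1 hu1
    h23 h12 p q
  have h2_3_3 := fun p q => hL <| isHeavy_of_arcs hv2 hvu2 hu2 hv3 hvu3 hu3 hv3 hvu3 hu3
    h23 h32 p q
  have h3_1_1 := fun p q => hL <| isHeavy_of_arcs hv3 hvu3 hu3 hv1 hvu1 hu1 hv1 hvu1 hu1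
    h31 h13 p q
  have h3_1_2 := fun p q => hL <| isHeavy_of_arcs hv3 hvu3 hu3 hv1 hvu1 hu1 hv2 hvu2 hu2
    h31 h23 p q
  have h3_2_1 := fun p q => hL <| isHeavy_of_arcs hv3 hvu3 hu3 hv2 hvu2 hu2 hv1 hvu1 hu1
    h32 h13 p q
  have h3_2_2 := fun p q => hL <| isHeavy_of_arcs hv3 hvu3 hu3 hv2 hvu2 hu2 hv2 hvu2 hu2
    h32 h23 p q
  grind
end

section
/- Let T be a light tournament, z a vertex of T, and i ≥ 3. Suppose V_i(z) is 2-in-dominated by a set {z_{i−1}, z'_{i−1}} ⊆ V_{i−1}(z) (possibly z_{i−1} = z'_{i−1}). Then both U := N(z_{i−1}) ∩ V_i(z) and S := V_i(z) − U induce triangle-free subtournaments of T. -/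
variable {V : Type*}

/-- In-neighborhood of a set `S`: vertices outside `S` with an arc into `S`. -/
def inNbhd (arc : V → V → Prop) (S : Set V) : Set V :=
  {v | v ∉ S ∧ ∃ u ∈ S, arc v u}

/-- `ball arc z i = V₁(z) ∪ ⋯ ∪ V_i(z)`: vertices with a directed path to `z`
of length at most `i - 1`. -/
def ball (arc : V → V → Prop) (z : V) : ℕ → Set V
  | 0 => ∅
  | 1 => {z}
  | (n + 2) => ball arc z (n + 1) ∪ inNbhd arc (ball arc z (n + 1))

/-- `layerV arc z i = V_i(z)`: the set of vertices whose shortest directed path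
to `z` has length exactly `i - 1` (so `V₁(z) = {z}` and
`V_{i+1}(z) = N(V₁(z) ∪ ⋯ ∪ V_i(z))`). -/
def layerV (arc : V → V → Prop) (z : V) (i : ℕ) : Set V :=
  ball arc z i \ ball arc z (i - 1)

/-- A vertex outside `ball arc z (n + 2)` is beaten by every vertex of `ball arc z (n + 1)`. -/
theorem arc_of_mem_ball_of_notMem_ball {arc : V → V → Prop} (hT : IsTournament arc) {z : V}
    {n : ℕ} {y s : V} (hy : y ∈ ball arc z (n + 1)) (hs : s ∉ ball arc z (n + 2)) :
    arc y s := by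
  have hs₁ : s ∉ ball arc z (n + 1) := fun h => hs (Or.inl h)
  have hne : y ≠ s := fun h => hs₁ (h ▸ hy)
  exact (hT.2 y s hne).2 fun h => hs (Or.inr ⟨hs₁, y, hy, h⟩)

/-- Two in-neighbors of a vertex of the preceding layer form a diagonal. -/
theorem isDiagonal_of_arc_layerV {arc : V → V → Prop} (hT : IsTournament arc) {z : V}
    {n : ℕ} {x a b : V} (hx : x ∈ layerV arc z (n + 2))
    (ha : a ∈ layerV arc z (n + 3)) (hb : b ∈ layerV arc z (n + 3))
    (hax : arc a x) (hbx : arc b x) : IsDiagonal arc a b := by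
  obtain ⟨hx | ⟨-, y, hy, hxy⟩, hx'⟩ := hx
  · exact absurd hx hx'
  · exact ⟨x, y, ⟨hxy, arc_of_mem_ball_of_notMem_ball hT hy ha.2, hax⟩,
      ⟨hxy, arc_of_mem_ball_of_notMem_ball hT hy hb.2, hbx⟩⟩

/-- In a light tournament, the in-neighbors of a vertex within the next layer induce a
triangle-free subtournament. -/
theorem IsLight.not_triangle_of_arc_layerV {arc : V → V → Prop} (hlight : IsLight arc)
    (hT : IsTournament arc) {z : V} {n : ℕ} {x a b c : V} (hx : x ∈ layerV arc z (n + 2))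
    (ha : a ∈ layerV arc z (n + 3)) (hb : b ∈ layerV arc z (n + 3))
    (hc : c ∈ layerV arc z (n + 3)) (hax : arc a x) (hbx : arc b x) (hcx : arc c x) :
    ¬ Triangle arc a b c := fun h =>
  hlight ⟨a, b, c, h, Or.inl ⟨isDiagonal_of_arc_layerV hT hx ha hb hax hbx,
    isDiagonal_of_arc_layerV hT hx hb hc hbx hcx⟩⟩

/-- In a light tournament, if `V_i(z)` (with `i ≥ 3`) is 2-in-dominated by
`{z₁, z₂} ⊆ V_{i-1}(z)` (possibly `z₁ = z₂`), then both `U := N(z₁) ∩ V_i(z)` and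
`S := V_i(z) \ U` induce triangle-free subtournaments. -/
theorem stmt6 [Fintype V] (arc : V → V → Prop) (hT : IsTournament arc)
    (hlight : IsLight arc) (z : V) (i : ℕ) (hi : 3 ≤ i) (z₁ z₂ : V)
    (hz₁ : z₁ ∈ layerV arc z (i - 1)) (hz₂ : z₂ ∈ layerV arc z (i - 1))
    (hdom : ∀ s ∈ layerV arc z i, arc s z₁ ∨ arc s z₂) :
    (∀ a ∈ inNbhd arc {z₁} ∩ layerV arc z i,
      ∀ b ∈ inNbhd arc {z₁} ∩ layerV arc z i,
        ∀ c ∈ inNbhd arc {z₁} ∩ layerV arc z i, ¬ Triangle arc a b c) ∧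
    (∀ a ∈ layerV arc z i \ (inNbhd arc {z₁} ∩ layerV arc z i),
      ∀ b ∈ layerV arc z i \ (inNbhd arc {z₁} ∩ layerV arc z i),
        ∀ c ∈ layerV arc z i \ (inNbhd arc {z₁} ∩ layerV arc z i),
          ¬ Triangle arc a b c) := by
  obtain ⟨n, rfl⟩ : ∃ n, i = n + 3 := ⟨i - 3, by omega⟩
  change z₁ ∈ layerV arc z (n + 2) at hz₁
  change z₂ ∈ layerV arc z (n + 2) at hz₂
  have hU : ∀ s ∈ inNbhd arc {z₁} ∩ layerV arc z (n + 3), arc s z₁ := by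
    rintro s ⟨⟨-, u, rfl, hu⟩, -⟩
    exact hu
  have hS : ∀ s ∈ layerV arc z (n + 3) \ (inNbhd arc {z₁} ∩ layerV arc z (n + 3)),
      arc s z₂ := by
    rintro s ⟨hs, hsU⟩
    refine (hdom s hs).resolve_left fun h => hsU ⟨⟨?_, z₁, rfl, h⟩, hs⟩
    rintro rfl
    exact hs.2 hz₁.1
  exact ⟨fun a ha b hb c hc => hlight.not_triangle_of_arc_layerV hT hz₁ ha.2 hb.2 hc.2
      (hU a ha) (hU b hb) (hU c hc),
    fun a ha b hb c hc => hlight.not_triangle_of_arc_layerV hT hz₂ ha.1 hb.1 hc.1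
      (hS a ha) (hS b hb) (hS c hc)⟩
end

section
/- Let T be a tournament with weight function w : V(T) → ℚ>0 in which every vertex lies in a directed triangle. Suppose x attains the minimum of Σ_{v} w(v)x_v over the basic relaxation P(T) and satisfies x_v < 1/2 for every vertex v. Then the minimum value SA₀(T,w) equals w(V(T))/3. -/
variable {V : Type*}

/-- The basic LP relaxation `P(T)`: `x ∈ [0,1]^V` with `x_a + x_b + x_c ≥ 1`
for every triangle. -/
def BasicFeasible (arc : V → V → Prop) (x : V → ℝ) : Prop :=
  (∀ v, 0 ≤ x v ∧ x v ≤ 1) ∧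
  ∀ a b c, Triangle arc a b c → 1 ≤ x a + x b + x c

/-- `SA₀(T,w)`: the optimum value of the basic relaxation. -/
noncomputable def SA0Val [Fintype V] (arc : V → V → Prop) (w : V → ℚ) : ℝ :=
  sInf {t : ℝ | ∃ x, BasicFeasible arc x ∧ t = ∑ v, (w v : ℝ) * x v}

/-- `SA₀(T,w)` is at most the value of any feasible point. -/
theorem SA0Val_le [Fintype V] {arc : V → V → Prop} {w : V → ℚ} (hw : ∀ v, 0 ≤ w v)
    {x : V → ℝ} (hx : BasicFeasible arc x) :
    SA0Val arc w ≤ ∑ v, (w v : ℝ) * x v := by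
  refine csInf_le ⟨0, ?_⟩ ⟨x, hx, rfl⟩
  rintro _ ⟨y, hy, rfl⟩
  exact Finset.sum_nonneg fun v _ => mul_nonneg (by exact_mod_cast hw v) (hy.1 v).1

/-- The constant `1/3` is feasible. -/
theorem basicFeasible_third (arc : V → V → Prop) : BasicFeasible arc fun _ => 1 / 3 :=
  ⟨fun _ => by norm_num, fun _ _ _ _ => by norm_num⟩

/-- Moving a feasible point away from the constant `1/3` keeps the triangle constraints,
hence feasibility as long as the box constraints have enough slack. -/
theorem BasicFeasible.add_mul_sub_third {arc : V → V → Prop} {x : V → ℝ}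
    (hx : BasicFeasible arc x) {ε : ℝ} (hε0 : 0 ≤ ε) (hε1 : ε ≤ 1)
    (hlow : ∀ v, ε ≤ x v) (hhalf : ∀ v, x v ≤ 1 / 2) :
    BasicFeasible arc fun v => x v + ε * (x v - 1 / 3) := by
  refine ⟨fun v => ⟨?_, ?_⟩, fun a b c h => ?_⟩
  · nlinarith [hlow v, mul_nonneg hε0 (hx.1 v).1]
  · nlinarith [hhalf v, mul_le_mul_of_nonneg_left (hhalf v) hε0]
  · nlinarith [hx.2 a b c h, mul_le_mul_of_nonneg_left (hx.2 a b c h) hε0]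

/-- Let `T` be a tournament with strictly positive weights in which every vertex
lies in a triangle. If some optimal solution `x` of the basic relaxation satisfies
`x_v < 1/2` for every vertex, then `SA₀(T,w) = w(V(T))/3`. -/
theorem stmt10 [Fintype V] (arc : V → V → Prop) (hT : IsTournament arc)
    (w : V → ℚ) (hw : ∀ v, 0 < w v)
    (htri : ∀ v : V, ∃ a b : V, Triangle arc v a b)
    (x : V → ℝ) (hx : BasicFeasible arc x)
    (hopt : ∑ v, (w v : ℝ) * x v = SA0Val arc w)
    (hhalf : ∀ v, x v < 1 / 2) :
    SA0Val arc w = (∑ v, (w v : ℝ)) / 3 := by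
  have hw' : ∀ v, 0 ≤ w v := fun v => (hw v).le
  have hpos : ∀ v, 0 < x v := fun v => by
    obtain ⟨a, b, h⟩ := htri v
    linarith [hx.2 v a b h, hhalf a, hhalf b]
  obtain ⟨ε, hε0, hε1, hlow⟩ : ∃ ε : ℝ, 0 < ε ∧ ε ≤ 1 ∧ ∀ v, ε ≤ x v := by
    rcases isEmpty_or_nonempty V with _ | _
    · exact ⟨1, one_pos, le_rfl, fun v => isEmptyElim v⟩
    · obtain ⟨u, hu⟩ := Finite.exists_min x
      exact ⟨x u, hpos u, (hx.1 u).2, hu⟩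
  have hupper := SA0Val_le hw' (basicFeasible_third arc)
  have hmove := SA0Val_le hw'
    (hx.add_mul_sub_third hε0.le hε1 hlow fun v => (hhalf v).le)
  have hsum : ∑ v, (w v : ℝ) * (x v + ε * (x v - 1 / 3)) =
      ∑ v, (w v : ℝ) * x v + ε * (∑ v, (w v : ℝ) * x v - (∑ v, (w v : ℝ)) / 3) := by
    rw [Finset.sum_div, ← Finset.sum_sub_distrib, Finset.mul_sum, ← Finset.sum_add_distrib]
    exact Finset.sum_congr rfl fun v _ => by ring
  rw [hsum, hopt] at hmove
  rw [← Finset.sum_mul] at hupper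
  have hlower : 0 ≤ SA0Val arc w - (∑ v, (w v : ℝ)) / 3 :=
    nonneg_of_mul_nonneg_right (by linarith) hε0
  linarith
end

section
/- Let T be a tournament with weight function w : V(T) → ℚ≥0, let x attain the minimum of Σ_v w(v)x_v over SA₁(T), and let F := {v ∈ V(T) : x_v ≥ 3/7}. Then w(F) ≤ (7/3)·(SA₁(T,w) − SA₁(T−F, w)). -/
variable {V : Type*}

/-- The constraints of the first level of the Sherali–Adams hierarchy for the
subtournament of `T` induced by the vertex set `A`: `x` is the vector of vertex
variables, `y` the (symmetric) lift over pairs. -/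
def SA1FeasibleOn (arc : V → V → Prop) (A : Set V) (x : V → ℝ) (y : V → V → ℝ) : Prop :=
  (∀ a ∈ A, ∀ b ∈ A, y a b = y b a) ∧
  (∀ a ∈ A, 0 ≤ x a ∧ x a ≤ 1) ∧
  (∀ a ∈ A, ∀ b ∈ A, ∀ c ∈ A, Triangle arc a b c →
    1 + y a b + y b c ≤ x a + x b + x c) ∧
  (∀ a ∈ A, ∀ b ∈ A, ∀ c ∈ A, ∀ d ∈ A, Triangle arc a b c →
    d ≠ a → d ≠ b → d ≠ c →
    x d ≤ y a d + y b d + y c d ∧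
    1 + y a d + y b d + y c d ≤ x a + x b + x c + x d) ∧
  (∀ a ∈ A, ∀ b ∈ A, a ≠ b → y a b ≤ x a ∧ 0 ≤ y a b)

/-- `SA₁(T[A], w)`: the optimum value of the level-1 Sherali-Adams relaxation of
the subtournament induced by `A`. -/
noncomputable def SA1ValOn [Fintype V] (arc : V → V → Prop) (A : Set V) (w : V → ℚ) : ℝ :=
  sInf {t : ℝ | ∃ x y, SA1FeasibleOn arc A x y ∧
    t = ∑ v, A.indicator (fun u => (w u : ℝ) * x u) v}

/-- The relaxation is inherited by induced subtournaments. -/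
theorem SA1FeasibleOn.mono {arc : V → V → Prop} {A B : Set V} {x : V → ℝ} {y : V → V → ℝ}
    (h : SA1FeasibleOn arc B x y) (hAB : A ⊆ B) : SA1FeasibleOn arc A x y := by
  obtain ⟨hsymm, hbox, htri, hquad, hpair⟩ := h
  exact ⟨fun a ha b hb => hsymm a (hAB ha) b (hAB hb),
    fun a ha => hbox a (hAB ha),
    fun a ha b hb c hc => htri a (hAB ha) b (hAB hb) c (hAB hc),
    fun a ha b hb c hc d hd => hquad a (hAB ha) b (hAB hb) c (hAB hc) d (hAB hd),
    fun a ha b hb => hpair a (hAB ha) b (hAB hb)⟩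

/-- The value of the relaxation is at most the cost of any feasible point. -/
theorem SA1ValOn_le [Fintype V] {arc : V → V → Prop} {A : Set V} {w : V → ℚ}
    (hw : ∀ v, 0 ≤ w v) {x : V → ℝ} {y : V → V → ℝ} (h : SA1FeasibleOn arc A x y) :
    SA1ValOn arc A w ≤ ∑ v, A.indicator (fun u => (w u : ℝ) * x u) v := by
  refine csInf_le ⟨0, ?_⟩ ⟨x, y, h, rfl⟩
  rintro t ⟨x', y', h', rfl⟩
  exact Finset.sum_nonneg fun v _ => Set.indicator_nonneg
    (fun u hu => mul_nonneg (by exact_mod_cast hw u) (h'.2.1 u hu).1) v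

/-- Let `x` (with lift `y`) attain the minimum of `SA₁(T,w)` and let
`F := {v : x_v ≥ 3/7}`. Then `w(F) ≤ (7/3)·(SA₁(T,w) - SA₁(T - F, w))`. -/
theorem stmt17 [Fintype V] (arc : V → V → Prop) (hT : IsTournament arc)
    (w : V → ℚ) (hw : ∀ v, 0 ≤ w v)
    (x : V → ℝ) (y : V → V → ℝ)
    (hxy : SA1FeasibleOn arc Set.univ x y)
    (hopt : ∑ v, (w v : ℝ) * x v = SA1ValOn arc Set.univ w) :
    ∑ v, ({v : V | 3 / 7 ≤ x v}).indicator (fun u => (w u : ℝ)) v ≤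
      7 / 3 * (SA1ValOn arc Set.univ w - SA1ValOn arc ({v : V | 3 / 7 ≤ x v})ᶜ w) := by
  have hle := SA1ValOn_le hw (hxy.mono (Set.subset_univ ({v : V | 3 / 7 ≤ x v})ᶜ))
  have hF : ∑ v, ({v : V | 3 / 7 ≤ x v}).indicator (fun u => (w u : ℝ)) v ≤
      7 / 3 * ∑ v, ({v : V | 3 / 7 ≤ x v}).indicator (fun u => (w u : ℝ) * x u) v := by
    rw [Finset.mul_sum]
    refine Finset.sum_le_sum fun v _ => ?_
    by_cases hv : v ∈ {v : V | 3 / 7 ≤ x v}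
    · rw [Set.indicator_of_mem hv, Set.indicator_of_mem hv]
      have hwv : (0 : ℝ) ≤ w v := by exact_mod_cast hw v
      linarith [mul_le_mul_of_nonneg_left (show 3 / 7 ≤ x v from hv) hwv]
    · simp [Set.indicator_of_notMem hv]
  have hsplit : ∑ v, ({v : V | 3 / 7 ≤ x v}).indicator (fun u => (w u : ℝ) * x u) v +
      ∑ v, ({v : V | 3 / 7 ≤ x v})ᶜ.indicator (fun u => (w u : ℝ) * x u) v =
      ∑ v, (w v : ℝ) * x v := by
    rw [← Finset.sum_add_distrib]
    exact Finset.sum_congr rfl fun v _ => Set.indicator_self_add_compl_apply _ _ v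
  linarith
end
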